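/- arXiv:0905.4062 — 13 statements merged into one kernel-verified Lean document; each statement's English description precedes it below -/
import Mathlib

section
/- The interaction system w1 ⊕ w2 is the coproduct of w1 and w2 in Int: the injections i1 = {(s1,(1,s1)) | s1 ∈ S1} and i2 = {(s2,(2,s2)) | s2 ∈ S2} are simulations from w1 (resp. w2) to w1 ⊕ w2, and for any interaction system w and simulations r1 from w1 to w and r2 from w2 to w, the copairing [r1,r2] = {((1,s1),s) | (s1,s) ∈ r1} ∪ {((2,s2),s) | (s2,s) ∈ r2} is the unique simulation from w1 ⊕ w2 to w whose composites with i1 and i2 are r1 and r2 respectively. -/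
/-- An interaction system on a set (type) of states `S`. -/
structure IS (S : Type) where
  A : S → Type
  D : (s : S) → A s → Type
  n : (s : S) → (a : A s) → D s a → S

/-- `r` is a simulation from `w1` to `w2`. -/
def Sim {S1 S2 : Type} (w1 : IS S1) (w2 : IS S2) (r : Set (S1 × S2)) : Prop :=
  ∀ ⦃s1 : S1⦄ ⦃s2 : S2⦄, (s1, s2) ∈ r →
    ∀ a1 : w1.A s1, ∃ a2 : w2.A s2,
      ∀ d2 : w2.D s2 a2, ∃ d1 : w1.D s1 a1,
        (w1.n s1 a1 d1, w2.n s2 a2 d2) ∈ r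

/-- Relational composition `r2 · r1` (first `r1`, then `r2`). -/
def relComp {S1 S2 S3 : Type} (r2 : Set (S2 × S3)) (r1 : Set (S1 × S2)) :
    Set (S1 × S3) :=
  {p | ∃ s2, (p.1, s2) ∈ r1 ∧ (s2, p.2) ∈ r2}

/-- The identity relation. -/
def idSRel {S : Type} : Set (S × S) := {p | p.1 = p.2}

/-- The converse of a relation. -/
def relConv {S1 S2 : Type} (r : Set (S1 × S2)) : Set (S2 × S1) :=
  {p | (p.2, p.1) ∈ r}

/-- The sum `w1 ⊕ w2` of two interaction systems. -/
def oplus {S1 S2 : Type} (w1 : IS S1) (w2 : IS S2) : IS (S1 ⊕ S2) where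
  A := fun s => match s with
    | .inl s1 => w1.A s1
    | .inr s2 => w2.A s2
  D := fun s => match s with
    | .inl s1 => fun a => w1.D s1 a
    | .inr s2 => fun a => w2.D s2 a
  n := fun s => match s with
    | .inl s1 => fun a d => .inl (w1.n s1 a d)
    | .inr s2 => fun a d => .inr (w2.n s2 a d)

/-- The copairing of two relations. -/
def copair {S1 S2 T : Type} (r1 : Set (S1 × T)) (r2 : Set (S2 × T)) :
    Set ((S1 ⊕ S2) × T) :=
  {p | (∃ s1, p.1 = Sum.inl s1 ∧ (s1, p.2) ∈ r1) ∨
       (∃ s2, p.1 = Sum.inr s2 ∧ (s2, p.2) ∈ r2)}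

/-- `w1 ⊕ w2` is the coproduct of `w1` and `w2` in `Int`. -/
theorem oplus_is_coproduct {S1 S2 : Type} (w1 : IS S1) (w2 : IS S2) :
    Sim w1 (oplus w1 w2) {p : S1 × (S1 ⊕ S2) | p.2 = Sum.inl p.1} ∧
    Sim w2 (oplus w1 w2) {p : S2 × (S1 ⊕ S2) | p.2 = Sum.inr p.1} ∧
    (∀ (T : Type) (w : IS T) (r1 : Set (S1 × T)) (r2 : Set (S2 × T)),
      Sim w1 w r1 → Sim w2 w r2 →
      Sim (oplus w1 w2) w (copair r1 r2) ∧
      relComp (copair r1 r2) {p : S1 × (S1 ⊕ S2) | p.2 = Sum.inl p.1} = r1 ∧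
      relComp (copair r1 r2) {p : S2 × (S1 ⊕ S2) | p.2 = Sum.inr p.1} = r2 ∧
      (∀ r' : Set ((S1 ⊕ S2) × T), Sim (oplus w1 w2) w r' →
        relComp r' {p : S1 × (S1 ⊕ S2) | p.2 = Sum.inl p.1} = r1 →
        relComp r' {p : S2 × (S1 ⊕ S2) | p.2 = Sum.inr p.1} = r2 →
        r' = copair r1 r2)) := by
  refine ⟨?_, ?_, fun T w r1 r2 h1 h2 => ⟨?_, ?_, ?_, ?_⟩⟩
  · rintro s1 _ (h : _ = Sum.inl s1)
    subst h
    intro a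
    exact ⟨a, fun d => ⟨d, rfl⟩⟩
  · rintro s2 _ (h : _ = Sum.inr s2)
    subst h
    intro a
    exact ⟨a, fun d => ⟨d, rfl⟩⟩
  · rintro _ t (⟨s, rfl, h⟩ | ⟨s, rfl, h⟩) a
    · obtain ⟨b, hb⟩ := h1 h a
      refine ⟨b, fun d => ?_⟩
      obtain ⟨e, he⟩ := hb d
      exact ⟨e, Or.inl ⟨_, rfl, he⟩⟩
    · obtain ⟨b, hb⟩ := h2 h a
      refine ⟨b, fun d => ?_⟩
      obtain ⟨e, he⟩ := hb d
      exact ⟨e, Or.inr ⟨_, rfl, he⟩⟩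
  · ext ⟨s, t⟩
    simp [relComp, copair]
  · ext ⟨s, t⟩
    simp [relComp, copair]
  · rintro r _ rfl rfl
    ext ⟨s | s, t⟩ <;> simp [relComp, copair]
end

section
/- The interaction system w1 ⊕ w2 is also the product of w1 and w2 in Int: the projections p1 = {((1,s1),s1) | s1 ∈ S1} and p2 = {((2,s2),s2) | s2 ∈ S2} are simulations from w1 ⊕ w2 to w1 (resp. w2), and for any interaction system w and simulations r1 from w to w1 and r2 from w to w2, the pairing ⟨r1,r2⟩ = {(s,(1,s1)) | (s,s1) ∈ r1} ∪ {(s,(2,s2)) | (s,s2) ∈ r2} is the unique simulation from w to w1 ⊕ w2 whose composites with p1 and p2 are r1 and r2 respectively. -/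
/-- The pairing of two relations. -/
def pairing {T S1 S2 : Type} (r1 : Set (T × S1)) (r2 : Set (T × S2)) :
    Set (T × (S1 ⊕ S2)) :=
  {p | (∃ s1, p.2 = Sum.inl s1 ∧ (p.1, s1) ∈ r1) ∨
       (∃ s2, p.2 = Sum.inr s2 ∧ (p.1, s2) ∈ r2)}

/-- `w1 ⊕ w2` is also the product of `w1` and `w2` in `Int`. -/
theorem oplus_is_product {S1 S2 : Type} (w1 : IS S1) (w2 : IS S2) :
    Sim (oplus w1 w2) w1 {p : (S1 ⊕ S2) × S1 | p.1 = Sum.inl p.2} ∧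
    Sim (oplus w1 w2) w2 {p : (S1 ⊕ S2) × S2 | p.1 = Sum.inr p.2} ∧
    (∀ (T : Type) (w : IS T) (r1 : Set (T × S1)) (r2 : Set (T × S2)),
      Sim w w1 r1 → Sim w w2 r2 →
      Sim w (oplus w1 w2) (pairing r1 r2) ∧
      relComp {p : (S1 ⊕ S2) × S1 | p.1 = Sum.inl p.2} (pairing r1 r2) = r1 ∧
      relComp {p : (S1 ⊕ S2) × S2 | p.1 = Sum.inr p.2} (pairing r1 r2) = r2 ∧
      (∀ r' : Set (T × (S1 ⊕ S2)), Sim w (oplus w1 w2) r' →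
        relComp {p : (S1 ⊕ S2) × S1 | p.1 = Sum.inl p.2} r' = r1 →
        relComp {p : (S1 ⊕ S2) × S2 | p.1 = Sum.inr p.2} r' = r2 →
        r' = pairing r1 r2)) := by
  refine ⟨?_, ?_, fun T w r1 r2 h1 h2 => ⟨?_, ?_, ?_, ?_⟩⟩
  · rintro x s (rfl : x = Sum.inl s) a
    exact ⟨a, fun d => ⟨d, rfl⟩⟩
  · rintro x s (rfl : x = Sum.inr s) a
    exact ⟨a, fun d => ⟨d, rfl⟩⟩
  · rintro t _ (⟨s, rfl, hs⟩ | ⟨s, rfl, hs⟩) a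
    · obtain ⟨b, hb⟩ := h1 hs a
      exact ⟨b, fun d => (hb d).imp fun _ he => .inl ⟨_, rfl, he⟩⟩
    · obtain ⟨b, hb⟩ := h2 hs a
      exact ⟨b, fun d => (hb d).imp fun _ he => .inr ⟨_, rfl, he⟩⟩
  · ext ⟨t, s⟩
    simp [relComp, pairing]
  · ext ⟨t, s⟩
    simp [relComp, pairing]
  · rintro r' - rfl rfl
    ext ⟨t, s | s⟩ <;> simp [relComp, pairing]
end

section
/- If r is a simulation from w1 to w1' and r' is a simulation from w2 to w2', then the relation r ⊗ r', defined by ((s1,s2),(s1',s2')) ∈ r ⊗ r' iff (s1,s1') ∈ r and (s2,s2') ∈ r', is a simulation from w1 ⊗ w2 to w1' ⊗ w2'. (Hence ⊗ is a bifunctor on Int.) -/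
/-- The synchronous tensor product. -/
def tensor {S1 S2 : Type} (w1 : IS S1) (w2 : IS S2) : IS (S1 × S2) where
  A s := w1.A s.1 × w2.A s.2
  D s a := w1.D s.1 a.1 × w2.D s.2 a.2
  n s a d := (w1.n s.1 a.1 d.1, w2.n s.2 a.2 d.2)

/-- Tensor of two relations. -/
def rtensor {S1 S2 T1 T2 : Type} (r : Set (S1 × T1)) (r' : Set (S2 × T2)) :
    Set ((S1 × S2) × (T1 × T2)) :=
  {p | (p.1.1, p.2.1) ∈ r ∧ (p.1.2, p.2.2) ∈ r'}

/-- The tensor of two simulations is a simulation. -/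
theorem tensor_of_sims {S1 S2 T1 T2 : Type}
    (w1 : IS S1) (w2 : IS S2) (w1' : IS T1) (w2' : IS T2)
    (r : Set (S1 × T1)) (r' : Set (S2 × T2))
    (h : Sim w1 w1' r) (h' : Sim w2 w2' r') :
    Sim (tensor w1 w2) (tensor w1' w2') (rtensor r r') := by
  rintro ⟨s1, s2⟩ ⟨t1, t2⟩ ⟨hr, hr'⟩ ⟨a1, a2⟩
  obtain ⟨b1, hb1⟩ := h hr a1
  obtain ⟨b2, hb2⟩ := h' hr' a2
  refine ⟨(b1, b2), ?_⟩
  rintro ⟨e1, e2⟩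
  obtain ⟨d1, hd1⟩ := hb1 e1
  obtain ⟨d2, hd2⟩ := hb2 e2
  exact ⟨(d1, d2), hd1, hd2⟩
end

section
/- For interaction systems w1, w2, w3 on S1, S2, S3, a relation r ⊆ (S1 × S2) × S3 is a simulation from w1 ⊗ w2 to w3 if and only if the corresponding relation r' ⊆ S1 × (S2 × S3), obtained by re-associating ((s1,s2),s3) to (s1,(s2,s3)), is a simulation from w1 to w2 ⊸ w3. (Hence ⊗ is left adjoint to ⊸ in Int, naturally in all three arguments.) -/
/-- The linear arrow `w1 ⊸ w2`. -/
def larrow {S1 S2 : Type} (w1 : IS S1) (w2 : IS S2) : IS (S1 × S2) where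
  A s := Σ f : w1.A s.1 → w2.A s.2,
           ∀ a1 : w1.A s.1, w2.D s.2 (f a1) → w1.D s.1 a1
  D s fG := Σ a1 : w1.A s.1, w2.D s.2 (fG.1 a1)
  n s fG ad := (w1.n s.1 ad.1 (fG.2 ad.1 ad.2), w2.n s.2 (fG.1 ad.1) ad.2)

/-- `⊗` is left adjoint to `⊸`. -/
theorem tensor_larrow_adjunction {S1 S2 S3 : Type}
    (w1 : IS S1) (w2 : IS S2) (w3 : IS S3) (r : Set ((S1 × S2) × S3)) :
    Sim (tensor w1 w2) w3 r ↔
    Sim w1 (larrow w2 w3) {p : S1 × (S2 × S3) | ((p.1, p.2.1), p.2.2) ∈ r} := by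
  constructor
  · rintro h s1 ⟨s2, s3⟩ hs a1
    choose f hf using fun a2 : w2.A s2 => h hs (a1, a2)
    choose g hg using hf
    exact ⟨⟨f, fun a2 d3 => (g a2 d3).2⟩, fun ⟨a2, d3⟩ => ⟨(g a2 d3).1, hg a2 d3⟩⟩
  · rintro h ⟨s1, s2⟩ s3 hs ⟨a1, a2⟩
    obtain ⟨⟨f, G⟩, hfG⟩ := @h s1 (s2, s3) hs a1
    refine ⟨f a2, fun d3 => ?_⟩
    obtain ⟨d1, hd⟩ := hfG ⟨a2, d3⟩
    exact ⟨(d1, G a2 d3), hd⟩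
end

section
/- For an interaction system w on S and a subset x ⊆ S, the relation {(*,s) | s ∈ x} ⊆ {*} × S is a simulation from I to w if and only if for every s ∈ x there exists a ∈ A(s) such that for every d ∈ D(s,a), s[a/d] ∈ x (i.e., x is a safety property for w). Consequently, a relation r ⊆ S1 × S2 is a simulation from w1 to w2 if and only if r, viewed as a subset of the state set S1 × S2 of w1 ⊸ w2, is a safety property for w1 ⊸ w2. -/
/-- The interaction system `I` without interaction, on a singleton set. -/
def unitI : IS PUnit where
  A _ := PUnit
  D _ _ := PUnit
  n _ _ _ := PUnit.unit

/-- `x` is a safety property for `w`. -/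
def Safety {S : Type} (w : IS S) (x : Set S) : Prop :=
  ∀ s ∈ x, ∃ a : w.A s, ∀ d : w.D s a, w.n s a d ∈ x

theorem sim_unitI_iff_safety {S : Type} (w : IS S) (x : Set S) :
    Sim unitI w {p : PUnit × S | p.2 ∈ x} ↔ Safety w x := by
  constructor
  · intro h s hs
    obtain ⟨a, ha⟩ := h (s1 := PUnit.unit) (s2 := s) hs PUnit.unit
    exact ⟨a, fun d => (ha d).choose_spec⟩
  · intro h _ s hs _
    obtain ⟨a, ha⟩ := h s hs
    exact ⟨a, fun d => ⟨PUnit.unit, ha d⟩⟩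

theorem sim_iff_safety_larrow {S1 S2 : Type} (w1 : IS S1) (w2 : IS S2)
    (r : Set (S1 × S2)) : Sim w1 w2 r ↔ Safety (larrow w1 w2) r := by
  constructor
  · rintro h ⟨s1, s2⟩ hs
    choose f G hG using h hs
    exact ⟨⟨f, G⟩, fun d => hG d.1 d.2⟩
  · intro h s1 s2 hs a1
    obtain ⟨⟨f, G⟩, hG⟩ := h (s1, s2) hs
    exact ⟨f a1, fun d2 => ⟨G a1 d2, hG ⟨a1, d2⟩⟩⟩

/-- Safety properties are the simulations from `I`, and simulations from `w1`
to `w2` are exactly the safety properties of `w1 ⊸ w2`. -/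
theorem safety_characterization :
    (∀ (S : Type) (w : IS S) (x : Set S),
      Sim unitI w {p : PUnit × S | p.2 ∈ x} ↔ Safety w x) ∧
    (∀ (S1 S2 : Type) (w1 : IS S1) (w2 : IS S2) (r : Set (S1 × S2)),
      Sim w1 w2 r ↔ Safety (larrow w1 w2) r) := by
  exact ⟨fun _ => sim_unitI_iff_safety, fun _ _ => sim_iff_safety_larrow⟩
end

section
/- For any interaction system w on S, the relation σ ⊆ List(S) × Mulf(S), relating a list to the multiset it represents (i.e., (l,μ) ∈ σ iff μ is the equivalence class of l under permutations), is a simulation from L(w) to !w, and its converse p is a simulation from !w to L(w); moreover σ and p form a bisimulation (each composite contains the respective identity relation restricted appropriately) but not an isomorphism. -/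
/-- Componentwise actions on a list of states. -/
def LA {S : Type} (w : IS S) : List S → Type
  | [] => PUnit
  | s :: l => w.A s × LA w l

/-- Componentwise reactions on a list of states. -/
def LD {S : Type} (w : IS S) : (l : List S) → LA w l → Type
  | [], _ => PUnit
  | s :: l, a => w.D s a.1 × LD w l a.2

/-- Componentwise next states on a list of states. -/
def Ln {S : Type} (w : IS S) : (l : List S) → (a : LA w l) → LD w l a → List S
  | [], _, _ => []
  | s :: l, a, d => w.n s a.1 d.1 :: Ln w l a.2 d.2

/-- The multithreaded interaction system `L(w)` on lists of states. -/
def Lsys {S : Type} (w : IS S) : IS (List S) where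
  A := LA w
  D := LD w
  n := Ln w

/-- The interaction system `!w` on finite multisets of states. -/
def bang {S : Type} (w : IS S) : IS (Multiset S) where
  A μ := Σ l : {l : List S // (l : Multiset S) = μ}, LA w l.val
  D _ a := LD w a.1.val a.2
  n _ a d := (Ln w a.1.val a.2 d : Multiset S)

/-- The relation relating a list to the multiset it represents. -/
def sigmaRel {S : Type} : Set (List S × Multiset S) :=
  {p | (p.1 : Multiset S) = p.2}

/-- An action on a list can be transported along a permutation so that every reaction to the
transported action comes from a reaction to the original one, with permuted next states. -/
lemma exists_action_of_perm {S : Type} (w : IS S) {l l' : List S} (h : l.Perm l') :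
    ∀ a : LA w l, ∃ a' : LA w l', ∀ d' : LD w l' a', ∃ d : LD w l a,
      (Ln w l a d).Perm (Ln w l' a' d') := by
  induction h with
  | nil => exact fun a => ⟨a, fun d => ⟨d, .refl _⟩⟩
  | cons s _ ih =>
    rintro ⟨a, as⟩
    obtain ⟨as', has⟩ := ih as
    refine ⟨(a, as'), fun ⟨d, ds'⟩ => ?_⟩
    obtain ⟨ds, hds⟩ := has ds'
    exact ⟨(d, ds), hds.cons _⟩
  | swap s t l =>
    rintro ⟨a, b, as⟩
    exact ⟨(b, a, as), fun ⟨d, e, ds⟩ => ⟨(e, d, ds), .swap _ _ _⟩⟩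
  | trans _ _ ih₁ ih₂ =>
    intro a
    obtain ⟨b, hb⟩ := ih₁ a
    obtain ⟨c, hc⟩ := ih₂ b
    refine ⟨c, fun d => ?_⟩
    obtain ⟨e, he⟩ := hc d
    obtain ⟨f, hf⟩ := hb e
    exact ⟨f, hf.trans he⟩

/-- `σ` is a simulation from `L(w)` to `!w`, its converse `p` is a simulation
from `!w` to `L(w)`; they form a bisimulation but not an isomorphism. -/
theorem sigma_bisimulation {S : Type} (w : IS S) :
    Sim (Lsys w) (bang w) (sigmaRel (S := S)) ∧
    Sim (bang w) (Lsys w) (relConv (sigmaRel (S := S))) ∧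
    (idSRel : Set (List S × List S)) ⊆ relComp (relConv sigmaRel) sigmaRel ∧
    (idSRel : Set (Multiset S × Multiset S)) ⊆ relComp sigmaRel (relConv sigmaRel) ∧
    ((∃ s t : S, s ≠ t) →
      relComp (relConv (sigmaRel (S := S))) sigmaRel ≠ (idSRel : Set (List S × List S))) := by
  refine ⟨?_, ?_, ?_, ?_, ?_⟩
  · intro l μ h a
    exact ⟨⟨⟨l, h⟩, a⟩, fun d => ⟨d, rfl⟩⟩
  · rintro μ l h ⟨⟨l', h'⟩, a⟩
    obtain ⟨b, hb⟩ := exists_action_of_perm w (Multiset.coe_eq_coe.1 (h'.trans h.symm)) a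
    refine ⟨b, fun d => ?_⟩
    obtain ⟨e, he⟩ := hb d
    exact ⟨e, Multiset.coe_eq_coe.2 he.symm⟩
  · rintro ⟨l, l'⟩ (rfl : l = l')
    exact ⟨l, rfl, rfl⟩
  · rintro ⟨μ, ν⟩ (rfl : μ = ν)
    obtain ⟨l, hl⟩ := Quot.exists_rep μ
    exact ⟨l, hl, hl⟩
  · rintro ⟨s, t, hst⟩ heq
    have hmem : ([s, t], [t, s]) ∈ relComp (relConv (sigmaRel (S := S))) sigmaRel :=
      ⟨([s, t] : List S), rfl, Multiset.coe_eq_coe.2 (.swap s t [])⟩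
    rw [heq] at hmem
    exact hst (List.cons.inj hmem).1
end

section
/- For any interaction system w on S, the relation e = {([], *)} ⊆ Mulf(S) × {*} is a simulation from !w to I, and the relation m = {(μ+ν, (μ,ν)) | μ,ν ∈ Mulf(S)} is a simulation from !w to !w ⊗ !w. -/
/-- An action on a list can be split along any decomposition of the underlying multiset, in such
a way that every pair of reactions to the two parts comes from a reaction to the whole. -/
theorem LA_exists_split {S : Type} (w : IS S) (l : List S) (a : LA w l) (μ ν : Multiset S)
    (h : (l : Multiset S) = μ + ν) :
    ∃ (l₁ l₂ : List S) (a₁ : LA w l₁) (a₂ : LA w l₂),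
      (l₁ : Multiset S) = μ ∧ (l₂ : Multiset S) = ν ∧
        ∀ (d₁ : LD w l₁ a₁) (d₂ : LD w l₂ a₂), ∃ d : LD w l a,
          (Ln w l a d : Multiset S) = (Ln w l₁ a₁ d₁ : Multiset S) + (Ln w l₂ a₂ d₂) := by
  induction l generalizing μ ν with
  | nil =>
    obtain ⟨rfl, rfl⟩ := add_eq_zero.mp h.symm
    exact ⟨[], [], PUnit.unit, PUnit.unit, rfl, rfl, fun _ _ => ⟨PUnit.unit, rfl⟩⟩
  | cons s l ih =>
    rw [← Multiset.cons_coe] at h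
    have hs : s ∈ μ + ν := h ▸ Multiset.mem_cons_self s _
    rcases Multiset.mem_add.mp hs with hs | hs
    · obtain ⟨μ', rfl⟩ := Multiset.exists_cons_of_mem hs
      rw [Multiset.cons_add, Multiset.cons_inj_right] at h
      obtain ⟨l₁, l₂, a₁, a₂, rfl, rfl, H⟩ := ih a.2 μ' ν h
      refine ⟨s :: l₁, l₂, (a.1, a₁), a₂, rfl, rfl, fun d₁ d₂ => ?_⟩
      obtain ⟨d, hd⟩ := H d₁.2 d₂
      refine ⟨(d₁.1, d), ?_⟩
      simp only [Ln, ← Multiset.cons_coe, hd, Multiset.cons_add]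
    · obtain ⟨ν', rfl⟩ := Multiset.exists_cons_of_mem hs
      rw [Multiset.add_cons, Multiset.cons_inj_right] at h
      obtain ⟨l₁, l₂, a₁, a₂, rfl, rfl, H⟩ := ih a.2 μ ν' h
      refine ⟨l₁, s :: l₂, a₁, (a.1, a₂), rfl, rfl, fun d₁ d₂ => ?_⟩
      obtain ⟨d, hd⟩ := H d₁ d₂.2
      refine ⟨(d₂.1, d), ?_⟩
      simp only [Ln, ← Multiset.cons_coe, hd, Multiset.add_cons]

/-- The counit and comultiplication of `!w` are simulations. -/
theorem bang_counit_comult_sim {S : Type} (w : IS S) :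
    Sim (bang w) unitI {p : Multiset S × PUnit | p.1 = 0} ∧
    Sim (bang w) (tensor (bang w) (bang w))
      {p : Multiset S × (Multiset S × Multiset S) | p.1 = p.2.1 + p.2.2} := by
  constructor
  · rintro _ _ hμ ⟨⟨l, rfl⟩, a⟩
    obtain rfl : l = [] := (Multiset.coe_eq_zero l).mp hμ
    exact ⟨PUnit.unit, fun _ => ⟨PUnit.unit, rfl⟩⟩
  · rintro _ ⟨μ, ν⟩ hμν ⟨⟨l, rfl⟩, a⟩
    obtain ⟨l₁, l₂, a₁, a₂, h₁, h₂, H⟩ := LA_exists_split w l a μ ν hμν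
    exact ⟨(⟨⟨l₁, h₁⟩, a₁⟩, ⟨⟨l₂, h₂⟩, a₂⟩), fun d => H d.1 d.2⟩
end

section
/- For any interaction system w on S, the triple (!w, e, m) with e = {([], *)} and m = {(μ+ν, (μ,ν)) | μ,ν ∈ Mulf(S)} is a commutative ⊗-comonoid in Int: as equalities of relations, (e ⊗ id)·m composed with the left-unit isomorphism is the identity on Mulf(S) (counit law, and symmetrically for (id ⊗ e)·m), (m ⊗ id)·m and (id ⊗ m)·m agree modulo the associativity isomorphism (coassociativity), and c·m = m where c is the swap relation {((μ,ν),(ν,μ))} (cocommutativity). -/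
/-- The counit of `!w`. -/
def bangE {S : Type} : Set (Multiset S × PUnit) := {p | p.1 = 0}

/-- The comultiplication of `!w`. -/
def bangM {S : Type} : Set (Multiset S × (Multiset S × Multiset S)) :=
  {p | p.1 = p.2.1 + p.2.2}

/-- A list of actions enumerating `μ + ν` splits into actions enumerating `μ` and `ν`, so that
reactions to both parts assemble into a reaction to the whole. -/
theorem LA_split {S : Type} (w : IS S) (l : List S) (a : LA w l) (μ ν : Multiset S)
    (h : (l : Multiset S) = μ + ν) :
    ∃ (a₁ : (bang w).A μ) (a₂ : (bang w).A ν),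
      ∀ (d₁ : (bang w).D μ a₁) (d₂ : (bang w).D ν a₂), ∃ d : LD w l a,
        (Ln w l a d : Multiset S) = (bang w).n μ a₁ d₁ + (bang w).n ν a₂ d₂ := by
  induction l generalizing μ ν with
  | nil =>
    obtain ⟨rfl, rfl⟩ : μ = 0 ∧ ν = 0 := by simpa using h.symm
    exact ⟨⟨⟨[], rfl⟩, PUnit.unit⟩, ⟨⟨[], rfl⟩, PUnit.unit⟩, fun _ _ => ⟨PUnit.unit, rfl⟩⟩
  | cons s l ih =>
    obtain ⟨a, b⟩ := a
    have hs : s ∈ μ + ν := by simp [← h]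
    rcases Multiset.mem_add.1 hs with hs | hs
    · obtain ⟨μ, rfl⟩ := Multiset.exists_cons_of_mem hs
      obtain ⟨⟨⟨l₁, h₁⟩, b₁⟩, a₂, H⟩ := ih b μ ν (by
        rwa [Multiset.cons_add, ← Multiset.cons_coe, Multiset.cons_inj_right] at h)
      refine ⟨⟨⟨s :: l₁, by rw [← h₁, Multiset.cons_coe]⟩, (a, b₁)⟩, a₂, ?_⟩
      rintro ⟨d, d₁⟩ d₂
      obtain ⟨d', hd⟩ := H d₁ d₂
      refine ⟨(d, d'), (congrArg (w.n s a d ::ₘ ·) hd).trans ?_⟩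
      exact (Multiset.cons_add _ _ _).symm
    · obtain ⟨ν, rfl⟩ := Multiset.exists_cons_of_mem hs
      obtain ⟨a₁, ⟨⟨l₂, h₂⟩, b₂⟩, H⟩ := ih b μ ν (by
        rwa [Multiset.add_cons, ← Multiset.cons_coe, Multiset.cons_inj_right] at h)
      refine ⟨a₁, ⟨⟨s :: l₂, by rw [← h₂, Multiset.cons_coe]⟩, (a, b₂)⟩, ?_⟩
      rintro d₁ ⟨d, d₂⟩
      obtain ⟨d', hd⟩ := H d₁ d₂
      refine ⟨(d, d'), (congrArg (w.n s a d ::ₘ ·) hd).trans ?_⟩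
      exact (Multiset.add_cons _ _ _).symm

/-- The counit of `!w` is a simulation. -/
theorem sim_bangE {S : Type} (w : IS S) : Sim (bang w) unitI (bangE (S := S)) := by
  rintro μ ⟨⟩ h ⟨⟨l, hl⟩, a⟩
  obtain rfl : l = [] := (Multiset.coe_eq_zero l).1 (hl.trans h)
  exact ⟨PUnit.unit, fun _ => ⟨PUnit.unit, rfl⟩⟩

/-- The comultiplication of `!w` is a simulation. -/
theorem sim_bangM {S : Type} (w : IS S) :
    Sim (bang w) (tensor (bang w) (bang w)) (bangM (S := S)) := by
  rintro _ ⟨μ, ν⟩ h ⟨⟨l, hl⟩, a⟩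
  obtain ⟨a₁, a₂, H⟩ := LA_split w l a μ ν (hl.trans h)
  exact ⟨(a₁, a₂), fun d => H d.1 d.2⟩

/-- `(!w, e, m)` is a commutative `⊗`-comonoid in `Int`. -/
theorem bang_commutative_comonoid {S : Type} (w : IS S) :
    Sim (bang w) unitI (bangE (S := S)) ∧
    Sim (bang w) (tensor (bang w) (bang w)) (bangM (S := S)) ∧
    -- counit laws (composed with the unit isomorphisms)
    relComp {p : (PUnit × Multiset S) × Multiset S | p.1.2 = p.2}
        (relComp (rtensor bangE idSRel) bangM) = (idSRel : Set (Multiset S × Multiset S)) ∧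
    relComp {p : (Multiset S × PUnit) × Multiset S | p.1.1 = p.2}
        (relComp (rtensor idSRel bangE) bangM) = (idSRel : Set (Multiset S × Multiset S)) ∧
    -- coassociativity (modulo the associativity isomorphism)
    relComp {p : ((Multiset S × Multiset S) × Multiset S) ×
                 (Multiset S × (Multiset S × Multiset S)) |
              p.1.1.1 = p.2.1 ∧ p.1.1.2 = p.2.2.1 ∧ p.1.2 = p.2.2.2}
        (relComp (rtensor bangM idSRel) bangM) = relComp (rtensor idSRel bangM) bangM ∧
    -- cocommutativity
    relComp {p : (Multiset S × Multiset S) × (Multiset S × Multiset S) |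
              p.1.1 = p.2.2 ∧ p.1.2 = p.2.1} bangM = bangM := by
  refine ⟨sim_bangE w, sim_bangM w, ?_, ?_, ?_, ?_⟩
  · ext ⟨μ, ν⟩
    simp [relComp, rtensor, bangE, bangM, idSRel]
  · ext ⟨μ, ν⟩
    simp [relComp, rtensor, bangE, bangM, idSRel]
  · ext ⟨μ, ν₁, ν₂, ν₃⟩
    simp [relComp, rtensor, bangM, idSRel, add_assoc]
  · ext ⟨μ, ν₁, ν₂⟩
    simp [relComp, bangM, add_comm]
end

section
/- For interaction systems w1 on S1 and w2 on S2, the relation that relates a finite multiset μ over S1 + S2 to the pair (μ1, μ2) of its restrictions to S1 and S2 is an isomorphism in Int from !(w1 ⊕ w2) to !w1 ⊗ !w2. -/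
/-- The relation relating a multiset over `S1 ⊕ S2` to the pair of its
restrictions. -/
def splitRel {S1 S2 : Type} :
    Set (Multiset (S1 ⊕ S2) × (Multiset S1 × Multiset S2)) :=
  {p | p.1 = p.2.1.map Sum.inl + p.2.2.map Sum.inr}

/-- A multiset over a sum type determines its two restrictions. -/
theorem map_inl_add_map_inr_inj {S1 S2 : Type} {μ1 ν1 : Multiset S1} {μ2 ν2 : Multiset S2}
    (h : μ1.map Sum.inl + μ2.map Sum.inr = ν1.map Sum.inl + ν2.map Sum.inr) :
    μ1 = ν1 ∧ μ2 = ν2 := by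
  have left (μ1 : Multiset S1) (μ2 : Multiset S2) :
      (μ1.map Sum.inl + μ2.map Sum.inr).filterMap Sum.getLeft? = μ1 := by
    induction μ1, μ2 using Quotient.inductionOn₂ with
    | _ l1 l2 => simp [List.filterMap_map, Function.comp_def]
  have right (μ1 : Multiset S1) (μ2 : Multiset S2) :
      (μ1.map Sum.inl + μ2.map Sum.inr).filterMap Sum.getRight? = μ2 := by
    induction μ1, μ2 using Quotient.inductionOn₂ with
    | _ l1 l2 => simp [List.filterMap_map, Function.comp_def]
  exact ⟨by rw [← left μ1 μ2, h, left], by rw [← right μ1 μ2, h, right]⟩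

theorem exists_eq_map_inl_add_map_inr {S1 S2 : Type} (μ : Multiset (S1 ⊕ S2)) :
    ∃ (μ1 : Multiset S1) (μ2 : Multiset S2), μ = μ1.map Sum.inl + μ2.map Sum.inr := by
  induction μ using Multiset.induction with
  | empty => exact ⟨0, 0, by simp⟩
  | cons s μ ih =>
    obtain ⟨μ1, μ2, rfl⟩ := ih
    rcases s with s | s
    · exact ⟨s ::ₘ μ1, μ2, by simp⟩
    · exact ⟨μ1, s ::ₘ μ2, by simp⟩

/-- Actions on a list over `S1 ⊕ S2` split into actions on the two restricted lists. -/
theorem exists_LA_split {S1 S2 : Type} (w1 : IS S1) (w2 : IS S2) (l : List (S1 ⊕ S2))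
    (a : LA (oplus w1 w2) l) :
    ∃ (l1 : List S1) (l2 : List S2) (a1 : LA w1 l1) (a2 : LA w2 l2),
      (l : Multiset (S1 ⊕ S2)) =
        (l1 : Multiset S1).map Sum.inl + (l2 : Multiset S2).map Sum.inr ∧
      ∀ (d1 : LD w1 l1 a1) (d2 : LD w2 l2 a2), ∃ d : LD (oplus w1 w2) l a,
        (Ln (oplus w1 w2) l a d : Multiset (S1 ⊕ S2)) =
          (Ln w1 l1 a1 d1 : Multiset S1).map Sum.inl +
            (Ln w2 l2 a2 d2 : Multiset S2).map Sum.inr := by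
  induction l with
  | nil => exact ⟨[], [], ⟨⟩, ⟨⟩, rfl, fun _ _ => ⟨⟨⟩, rfl⟩⟩
  | cons s l ih =>
    obtain ⟨b, a⟩ := a
    obtain ⟨l1, l2, a1, a2, hl, hd⟩ := ih a
    rcases s with s | s
    · refine ⟨s :: l1, l2, (b, a1), a2, ?_, ?_⟩
      · rw [← Multiset.cons_coe, ← Multiset.cons_coe, hl, Multiset.map_cons, Multiset.cons_add]
      · rintro ⟨e, d1⟩ d2
        obtain ⟨d, h⟩ := hd d1 d2
        refine ⟨(e, d), ?_⟩
        simp only [Ln, ← Multiset.cons_coe, h, Multiset.map_cons, Multiset.cons_add]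
        rfl
    · refine ⟨l1, s :: l2, a1, (b, a2), ?_, ?_⟩
      · rw [← Multiset.cons_coe, ← Multiset.cons_coe, hl, Multiset.map_cons, Multiset.add_cons]
      · rintro d1 ⟨e, d2⟩
        obtain ⟨d, h⟩ := hd d1 d2
        refine ⟨(e, d), ?_⟩
        simp only [Ln, ← Multiset.cons_coe, h, Multiset.map_cons, Multiset.add_cons]
        rfl

/-- Actions on a list over `S1` and a list over `S2` join into actions on a list over
`S1 ⊕ S2`. -/
theorem exists_LA_join {S1 S2 : Type} (w1 : IS S1) (w2 : IS S2) (l1 : List S1) (l2 : List S2)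
    (a1 : LA w1 l1) (a2 : LA w2 l2) :
    ∃ (l : List (S1 ⊕ S2)) (a : LA (oplus w1 w2) l),
      (l : Multiset (S1 ⊕ S2)) =
        (l1 : Multiset S1).map Sum.inl + (l2 : Multiset S2).map Sum.inr ∧
      ∀ d : LD (oplus w1 w2) l a, ∃ (d1 : LD w1 l1 a1) (d2 : LD w2 l2 a2),
        (Ln (oplus w1 w2) l a d : Multiset (S1 ⊕ S2)) =
          (Ln w1 l1 a1 d1 : Multiset S1).map Sum.inl +
            (Ln w2 l2 a2 d2 : Multiset S2).map Sum.inr := by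
  induction l1 with
  | nil =>
    induction l2 with
    | nil => exact ⟨[], ⟨⟩, rfl, fun _ => ⟨⟨⟩, ⟨⟩, rfl⟩⟩
    | cons s l2 ih =>
      obtain ⟨b, a2⟩ := a2
      obtain ⟨l, a, hl, hd⟩ := ih a2
      refine ⟨Sum.inr s :: l, (b, a), ?_, ?_⟩
      · rw [← Multiset.cons_coe, ← Multiset.cons_coe, hl, Multiset.map_cons, Multiset.add_cons]
      · rintro ⟨e, d⟩
        obtain ⟨d1, d2, h⟩ := hd d
        refine ⟨d1, (e, d2), ?_⟩
        simp only [Ln, ← Multiset.cons_coe] at h ⊢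
        simp only [h, Multiset.map_cons, Multiset.add_cons]
        rfl
  | cons s l1 ih =>
    obtain ⟨b, a1⟩ := a1
    obtain ⟨l, a, hl, hd⟩ := ih a1
    refine ⟨Sum.inl s :: l, (b, a), ?_, ?_⟩
    · rw [← Multiset.cons_coe, ← Multiset.cons_coe, hl, Multiset.map_cons, Multiset.cons_add]
    · rintro ⟨e, d⟩
      obtain ⟨d1, d2, h⟩ := hd d
      refine ⟨(e, d1), d2, ?_⟩
      simp only [Ln, ← Multiset.cons_coe, h, Multiset.map_cons, Multiset.cons_add]
      rfl

/-- `!(w1 ⊕ w2) ≅ !w1 ⊗ !w2` in `Int`. -/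
theorem bang_oplus_iso {S1 S2 : Type} (w1 : IS S1) (w2 : IS S2) :
    Sim (bang (oplus w1 w2)) (tensor (bang w1) (bang w2)) (splitRel (S1 := S1) (S2 := S2)) ∧
    Sim (tensor (bang w1) (bang w2)) (bang (oplus w1 w2)) (relConv splitRel) ∧
    relComp (relConv (splitRel (S1 := S1) (S2 := S2))) splitRel =
      (idSRel : Set (Multiset (S1 ⊕ S2) × Multiset (S1 ⊕ S2))) ∧
    relComp (splitRel (S1 := S1) (S2 := S2)) (relConv splitRel) =
      (idSRel : Set ((Multiset S1 × Multiset S2) × (Multiset S1 × Multiset S2))) := by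
  refine ⟨?_, ?_, ?_, ?_⟩
  · rintro μ ⟨μ1, μ2⟩ h ⟨⟨l, rfl⟩, a⟩
    obtain ⟨l1, l2, a1, a2, hl, hd⟩ := exists_LA_split w1 w2 l a
    obtain ⟨h1, h2⟩ := map_inl_add_map_inr_inj (hl.symm.trans h)
    refine ⟨(⟨⟨l1, h1⟩, a1⟩, ⟨⟨l2, h2⟩, a2⟩), ?_⟩
    rintro ⟨d1, d2⟩
    exact hd d1 d2
  · rintro ⟨μ1, μ2⟩ μ h ⟨⟨⟨l1, h1⟩, a1⟩, ⟨⟨l2, h2⟩, a2⟩⟩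
    obtain ⟨l, a, hl, hd⟩ := exists_LA_join w1 w2 l1 l2 a1 a2
    have hμ : (l : Multiset (S1 ⊕ S2)) = μ := by
      rw [hl, h1, h2]
      exact h.symm
    refine ⟨⟨⟨l, hμ⟩, a⟩, fun d => ?_⟩
    obtain ⟨d1, d2, h⟩ := hd d
    exact ⟨(d1, d2), h⟩
  · ext ⟨μ, ν⟩
    constructor
    · rintro ⟨p, h1, h2⟩
      exact Eq.trans h1 (Eq.symm h2)
    · rintro (rfl : μ = ν)
      obtain ⟨μ1, μ2, h⟩ := exists_eq_map_inl_add_map_inr μ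
      exact ⟨(μ1, μ2), h, h⟩
  · ext ⟨⟨μ1, μ2⟩, ⟨ν1, ν2⟩⟩
    constructor
    · rintro ⟨μ, h1, h2⟩
      obtain ⟨h1, h2⟩ := map_inl_add_map_inr_inj (Eq.trans (Eq.symm h1) h2)
      exact Prod.ext h1 h2
    · intro h
      obtain ⟨rfl, rfl⟩ := Prod.mk.inj h
      exact ⟨μ1.map Sum.inl + μ2.map Sum.inr, Eq.refl _, Eq.refl _⟩
end

section
/- For any interaction system w on S, the identity relation on S is an isomorphism in Int between w and w^⊥⊥: the identity relation is a simulation from w to w^⊥⊥ and a simulation from w^⊥⊥ to w. (Equivalently, the object ⊥ = I is dualizing in Int; the proof uses the contrapositive of the axiom of choice.) -/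
/-- The dual `w^⊥` of an interaction system. -/
def dual {S : Type} (w : IS S) : IS S where
  A s := ∀ a : w.A s, w.D s a
  D s _ := w.A s
  n s f a := w.n s a (f a)

/-- The identity relation is an isomorphism between `w` and `w^⊥⊥`. -/
theorem dual_dual_iso {S : Type} (w : IS S) :
    Sim w (dual (dual w)) (idSRel : Set (S × S)) ∧
    Sim (dual (dual w)) w (idSRel : Set (S × S)) := by
  constructor
  · intro s t (hst : s = t)
    subst hst
    intro a
    exact ⟨fun _ => a, fun f => ⟨f a, rfl⟩⟩
  · intro s t (hst : s = t)
    subst hst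
    intro F
    by_contra! h
    choose g hg using h
    exact hg (F g) g rfl
end

section
/- Every interaction system w is isomorphic in Int to an interaction system on the same set of states in which the set of reactions does not depend on the chosen action: for every state s, the function a ↦ D(s,a) is constant. (Indeed w^⊥⊥ has this property and is isomorphic to w via the identity relation.) -/
/-- Every strategy `F` against choice functions has an action `a` such that every `d : D a` is
the value at `a` of some choice function to which `F` answers `a`. -/
theorem exists_action_forall_reaction {A : Type} {D : A → Type} (F : (∀ a, D a) → A) :
    ∃ a, ∀ d : D a, ∃ f : ∀ a, D a, (⟨F f, f (F f)⟩ : Sigma D) = ⟨a, d⟩ := by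
  by_contra! h
  choose f hf using h
  exact hf (F f) f rfl

theorem sim_dual_dual {S : Type} (w : IS S) : Sim w (dual (dual w)) idSRel := by
  rintro s t (h : s = t) a
  subst h
  exact ⟨fun _ => a, fun f => ⟨f a, rfl⟩⟩

theorem dual_dual_sim {S : Type} (w : IS S) : Sim (dual (dual w)) w idSRel := by
  rintro s t (h : s = t) F
  subst h
  obtain ⟨a, ha⟩ := exists_action_forall_reaction F
  refine ⟨a, fun d => ?_⟩
  obtain ⟨f, hf⟩ := ha d
  exact ⟨f, congrArg (fun p : Sigma (w.D s) => w.n s p.1 p.2) hf⟩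

theorem relConv_idSRel {S : Type} : relConv (idSRel : Set (S × S)) = idSRel := by
  ext p
  exact eq_comm

theorem relComp_idSRel {S : Type} : relComp idSRel (idSRel : Set (S × S)) = idSRel := by
  ext p
  simp [relComp, idSRel]

/-- Every interaction system is isomorphic to one whose reaction sets do not
depend on the chosen action. -/
theorem iso_to_action_independent_reactions {S : Type} (w : IS S) :
    ∃ (w' : IS S) (r : Set (S × S)),
      (∀ s : S, ∀ a a' : w'.A s, w'.D s a = w'.D s a') ∧
      Sim w w' r ∧ Sim w' w (relConv r) ∧
      relComp (relConv r) r = (idSRel : Set (S × S)) ∧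
      relComp r (relConv r) = (idSRel : Set (S × S)) := by
  refine ⟨dual (dual w), idSRel, fun _ _ _ => rfl, sim_dual_dual w, ?_⟩
  rw [relConv_idSRel]
  exact ⟨dual_dual_sim w, relComp_idSRel, relComp_idSRel⟩
end

section
/- For interaction systems w1 on S1 and w2 on S2, a relation r ⊆ S1 × S2 is a simulation from w1 to w2 if and only if r is a forward data-refinement from the predicate transformer w1° to the predicate transformer w2°, i.e., for every subset x ⊆ S1, ⟨r⟩(w1°(x)) ⊆ w2°(⟨r⟩(x)). (This is the morphism part of a full and faithful functor from Int to the category PT of predicate transformers.) -/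
/-- The predicate transformer `w°` associated to `w`. -/
def pt {S : Type} (w : IS S) : Set S → Set S :=
  fun x => {s | ∃ a : w.A s, ∀ d : w.D s a, w.n s a d ∈ x}

/-- The direct image of a relation. -/
def dimg {S1 S2 : Type} (r : Set (S1 × S2)) (x : Set S1) : Set S2 :=
  {s2 | ∃ s1 ∈ x, (s1, s2) ∈ r}

/-- `r` is a simulation iff it is a forward data-refinement between the
associated predicate transformers. -/
theorem sim_iff_forward_data_refinement {S1 S2 : Type}
    (w1 : IS S1) (w2 : IS S2) (r : Set (S1 × S2)) :
    Sim w1 w2 r ↔ ∀ x : Set S1, dimg r (pt w1 x) ⊆ pt w2 (dimg r x) := by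
  constructor
  · rintro h x s2 ⟨s1, ⟨a1, ha1⟩, hr⟩
    obtain ⟨a2, ha2⟩ := h hr a1
    refine ⟨a2, fun d2 => ?_⟩
    obtain ⟨d1, hd1⟩ := ha2 d2
    exact ⟨_, ha1 d1, hd1⟩
  · intro h s1 s2 hr a1
    obtain ⟨a2, ha2⟩ :=
      h (Set.range (w1.n s1 a1)) ⟨s1, ⟨a1, fun d1 => Set.mem_range_self d1⟩, hr⟩
    refine ⟨a2, fun d2 => ?_⟩
    obtain ⟨_, ⟨d1, rfl⟩, hd1⟩ := ha2 d2
    exact ⟨d1, hd1⟩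
end

section
/- Let F be a monotonic function from subsets of S to subsets of S, and let 𝓕(F) be the interaction system on S with A(s) = {x ⊆ S | s ∈ F(x)}, D(s,x) = x, and n(s,x,s') = s'. Then the predicate transformer 𝓕(F)° associated to 𝓕(F) is equal to F: for every subset x ⊆ S and every s ∈ S, s ∈ 𝓕(F)°(x) if and only if s ∈ F(x). -/
/-- The interaction system associated to a predicate transformer. -/
def FIS {S : Type} (F : Set S → Set S) : IS S where
  A s := {x : Set S // s ∈ F x}
  D _ x := ↥x.val
  n _ _ s' := s'.val

/-- The predicate transformer associated to `FIS F` is `F` itself. -/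
theorem pt_FIS_eq {S : Type} (F : Set S → Set S) (hF : Monotone F) :
    ∀ (x : Set S) (s : S), s ∈ pt (FIS F) x ↔ s ∈ F x := by
  intro x s
  constructor
  · rintro ⟨⟨y, hy⟩, h⟩
    exact hF (fun d hd => h ⟨d, hd⟩) hy
  · intro hs
    exact ⟨⟨x, hs⟩, fun d => d.property⟩
end
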